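/- Let y₀, y₁, y₂ be positive odd integers with y₀·y₁·y₂ squarefree, and suppose y₀ ≡ y₁ (mod 4) and y₂ ≡ −y₀ (mod 4). Then ρ(y₀,y₁,y₂) = 0. -/

import Mathlib

/-- `ρ(y₀,y₁,y₂) = ∏_{odd p ∣ y₀}(1 + (y₁y₂/p)) ∏_{odd p ∣ y₁}(1 + (y₀y₂/p))
∏_{odd p ∣ y₂}(1 + (−y₀y₁/p))`, the symbols being Legendre symbols. -/
def rho (y0 y1 y2 : ℕ) : ℤ :=
  (∏ p ∈ y0.primeFactors.filter (· ≠ 2), (1 + jacobiSym ((y1 : ℤ) * y2) p)) *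
  (∏ p ∈ y1.primeFactors.filter (· ≠ 2), (1 + jacobiSym ((y0 : ℤ) * y2) p)) *
  (∏ p ∈ y2.primeFactors.filter (· ≠ 2), (1 + jacobiSym (-((y0 : ℤ) * y1)) p))

open scoped NumberTheorySymbols in
/-- If `J(a | n) = -1` with `n` odd, some odd prime `p ∣ n` has `J(a | p) = -1`, so the product of
the `1 + J(a | p)` vanishes. -/
theorem prod_one_add_jacobiSym_eq_zero {a : ℤ} {n : ℕ} (hn : Odd n) (h : J(a | n) = -1) :
    ∏ p ∈ n.primeFactors.filter (· ≠ 2), (1 + J(a | p)) = 0 := by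
  obtain ⟨p, hp, hpn, hJ⟩ := jacobiSym.eq_neg_one_at_prime_divisor_of_eq_neg_one h
  refine Finset.prod_eq_zero (i := p) ?_ (by rw [hJ]; norm_num)
  refine Finset.mem_filter.2 ⟨Nat.mem_primeFactors.2 ⟨hp, hpn, hn.pos.ne'⟩, ?_⟩
  rintro rfl
  exact Nat.not_even_iff_odd.2 hn (even_iff_two_dvd.2 hpn)

open scoped NumberTheorySymbols in
/-- Quadratic reciprocity for three pairwise coprime odd numbers with
`y₀ ≡ y₁ ≡ -y₂ (mod 4)`. -/
theorem jacobiSym_triple_product_eq_neg_one {y0 y1 y2 : ℕ}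
    (ho0 : Odd y0) (ho1 : Odd y1) (ho2 : Odd y2)
    (h01 : y0.Coprime y1) (h02 : y0.Coprime y2) (h12 : y1.Coprime y2)
    (hmod : y0 % 4 = 1 ∧ y1 % 4 = 1 ∧ y2 % 4 = 3 ∨ y0 % 4 = 3 ∧ y1 % 4 = 3 ∧ y2 % 4 = 1) :
    J((y1 : ℤ) * y2 | y0) * J((y0 : ℤ) * y2 | y1) * J(-((y0 : ℤ) * y1) | y2) = -1 := by
  have s01 : J((y0 : ℤ) | y1) ^ 2 = 1 := jacobiSym.sq_one (by simpa using h01)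
  have s02 : J((y0 : ℤ) | y2) ^ 2 = 1 := jacobiSym.sq_one (by simpa using h02)
  have s12 : J((y1 : ℤ) | y2) ^ 2 = 1 := jacobiSym.sq_one (by simpa using h12)
  rw [jacobiSym.neg _ ho2, jacobiSym.mul_left, jacobiSym.mul_left, jacobiSym.mul_left]
  rcases hmod with ⟨m0, m1, m2⟩ | ⟨m0, m1, m2⟩
  · rw [ZMod.χ₄_nat_three_mod_four m2,
      ← jacobiSym.quadratic_reciprocity_one_mod_four m0 ho1,
      ← jacobiSym.quadratic_reciprocity_one_mod_four m0 ho2,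
      ← jacobiSym.quadratic_reciprocity_one_mod_four m1 ho2]
    linear_combination -J((y0 : ℤ) | y2) ^ 2 * J((y1 : ℤ) | y2) ^ 2 * s01
      - J((y1 : ℤ) | y2) ^ 2 * s02 - s12
  · rw [ZMod.χ₄_nat_one_mod_four m2,
      jacobiSym.quadratic_reciprocity_three_mod_four m1 m0,
      jacobiSym.quadratic_reciprocity_one_mod_four m2 ho0,
      jacobiSym.quadratic_reciprocity_one_mod_four m2 ho1]
    linear_combination -J((y0 : ℤ) | y2) ^ 2 * J((y1 : ℤ) | y2) ^ 2 * s01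
      - J((y1 : ℤ) | y2) ^ 2 * s02 - s12

/-- If `y₀ ≡ y₁ ≡ −y₂ (mod 4)` then `ρ(y₀,y₁,y₂) = 0`. -/
theorem rho_eq_zero_of_congruence (y0 y1 y2 : ℕ)
    (h0 : 0 < y0) (h1 : 0 < y1) (h2 : 0 < y2)
    (ho0 : Odd y0) (ho1 : Odd y1) (ho2 : Odd y2)
    (hsq : Squarefree (y0 * y1 * y2))
    (hcong1 : (y0 : ℤ) ≡ (y1 : ℤ) [ZMOD 4])
    (hcong2 : (y2 : ℤ) ≡ -(y0 : ℤ) [ZMOD 4]) :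
    rho y0 y1 y2 = 0 := by
  obtain ⟨c2, hsq01, -⟩ := Nat.squarefree_mul_iff.1 hsq
  have h01 := (Nat.squarefree_mul_iff.1 hsq01).1
  obtain ⟨h02, h12⟩ := Nat.coprime_mul_iff_left.1 c2
  have hmod : y0 % 4 = 1 ∧ y1 % 4 = 1 ∧ y2 % 4 = 3 ∨
      y0 % 4 = 3 ∧ y1 % 4 = 3 ∧ y2 % 4 = 1 := by
    rw [Nat.odd_iff] at ho0
    unfold Int.ModEq at hcong1 hcong2
    omega
  have key := jacobiSym_triple_product_eq_neg_one ho0 ho1 ho2 h01 h02 h12 hmod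
  unfold rho
  rcases jacobiSym.trichotomy ((y1 : ℤ) * y2) y0 with ha | ha | ha
  · simp [ha] at key
  · rcases jacobiSym.trichotomy ((y0 : ℤ) * y2) y1 with hb | hb | hb
    · simp [hb] at key
    · rw [ha, hb, one_mul, one_mul] at key
      rw [prod_one_add_jacobiSym_eq_zero ho2 key, mul_zero]
    · rw [prod_one_add_jacobiSym_eq_zero ho1 hb, mul_zero, zero_mul]
  · rw [prod_one_add_jacobiSym_eq_zero ho0 ha, zero_mul, zero_mul]
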